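/- arXiv:1007.3426 — 6 statements merged into one kernel-verified Lean document; each statement's English description precedes it below -/
import Mathlib

section
/- Let k be a field, V a finite-dimensional k-vector space, and 2 ≤ a < b integers. Let R_a ⊆ V^{⊗a} and R_b ⊆ V^{⊗b} be subspaces, viewed inside the tensor algebra T(V) via the canonical identification of V^{⊗n} with the degree-n component of T(V). If the subspace (Σ_{i+j+a=b} V^{⊗i}⊗R_a⊗V^{⊗j}) ∩ R_b of V^{⊗b} is nonzero, then there exists a proper subspace R_b' ⊊ R_b such that the two-sided ideal of T(V) generated by R_a ∪ R_b' equals the two-sided ideal of T(V) generated by R_a ∪ R_b. -/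
/-- The degree-`n` component `V^{⊗n}` of the tensor algebra of `V`, realized as the
`n`-th power of the image of `V` in `T(V)`.  Via the canonical identification of the
tensor algebra with `⊕ₙ V^{⊗n}`, a subspace of `V^{⊗n}` is a submodule of `T(V)`
contained in `tpow k V n`, and the tensor product of subspaces corresponds to the
multiplication of submodules of the algebra `T(V)`. -/
noncomputable def tpow (k V : Type*) [CommSemiring k] [AddCommMonoid V] [Module k V]
    (n : ℕ) : Submodule k (TensorAlgebra k V) :=
  (LinearMap.range (TensorAlgebra.ι k (M := V))) ^ n

/-- If `S ⊓ N` is nonzero, then `N` is the sum of `S ⊓ N` and a proper subspace of `N`. -/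
theorem Submodule.exists_lt_sup_inf_eq {k M : Type*} [DivisionRing k] [AddCommGroup M] [Module k M]
    {S N : Submodule k M} (h : S ⊓ N ≠ ⊥) : ∃ N' < N, S ⊓ N ⊔ N' = N := by
  obtain ⟨C, hC⟩ := exists_isCompl (S ⊓ N)
  have hsup : S ⊓ N ⊔ C ⊓ N = N := by
    rw [← sup_inf_assoc_of_le C inf_le_right, hC.sup_eq_top, top_inf_eq]
  refine ⟨C ⊓ N, lt_of_le_of_ne inf_le_right fun hN => h ?_, hsup⟩
  exact hC.disjoint.eq_bot_of_le (inf_le_right.trans (inf_eq_right.mp hN))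

/-- The product `P * R * Q` of subspaces lies in every two-sided ideal containing `R`. -/
theorem TwoSidedIdeal.mem_of_mem_mul_mul {k A : Type*} [CommRing k] [Ring A] [Algebra k A]
    (I : TwoSidedIdeal A) {P R Q : Submodule k A} (hR : ∀ r ∈ R, r ∈ I) {x : A}
    (hx : x ∈ P * R * Q) : x ∈ I := by
  induction hx using Submodule.mul_induction_on' with
  | mem_mul_mem y hy z hz =>
    refine I.mul_mem_right _ _ ?_
    induction hy using Submodule.mul_induction_on' with
    | mem_mul_mem p hp r hr => exact I.mul_mem_left _ _ (hR r hr)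
    | add u _ v _ hu hv => exact I.add_mem hu hv
  | add u _ v _ hu hv => exact I.add_mem hu hv

/-- if `R_a ⊆ V^{⊗a}`, `R_b ⊆ V^{⊗b}` (`2 ≤ a < b`) are subspaces, viewed
inside `T(V)`, and `(Σ_{i+j+a=b} V^{⊗i}⊗R_a⊗V^{⊗j}) ∩ R_b ≠ 0`, then there is a proper
subspace `R_b' ⊊ R_b` such that the two-sided ideal of `T(V)` generated by `R_a ∪ R_b'`
equals the two-sided ideal generated by `R_a ∪ R_b`. -/
theorem stmt5 (k V : Type*) [Field k] [AddCommGroup V] [Module k V]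
    [FiniteDimensional k V]
    (a b : ℕ) (ha : 2 ≤ a) (hab : a < b)
    (Ra Rb : Submodule k (TensorAlgebra k V))
    (hRa : Ra ≤ tpow k V a) (hRb : Rb ≤ tpow k V b)
    (h : (⨆ (i : ℕ) (j : ℕ) (_ : i + j + a = b), tpow k V i * Ra * tpow k V j) ⊓ Rb ≠ ⊥) :
    ∃ Rb' : Submodule k (TensorAlgebra k V), Rb' < Rb ∧
      TwoSidedIdeal.span ((Ra : Set (TensorAlgebra k V)) ∪ (Rb' : Set (TensorAlgebra k V)))
        = TwoSidedIdeal.span ((Ra : Set (TensorAlgebra k V)) ∪ (Rb : Set (TensorAlgebra k V))) := by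
  obtain ⟨Rb', hlt, hsup⟩ := Submodule.exists_lt_sup_inf_eq h
  refine ⟨Rb', hlt, le_antisymm (TwoSidedIdeal.span_mono (Set.union_subset_union_right _ hlt.le)) ?_⟩
  set I := TwoSidedIdeal.span ((Ra : Set (TensorAlgebra k V)) ∪ (Rb' : Set (TensorAlgebra k V)))
  have hRaI : ∀ r ∈ Ra, r ∈ I := fun r hr => TwoSidedIdeal.subset_span (Or.inl hr)
  have hS : ∀ x ∈ ⨆ (i : ℕ) (j : ℕ) (_ : i + j + a = b), tpow k V i * Ra * tpow k V j, x ∈ I := by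
    have hle : ⨆ (i : ℕ) (j : ℕ) (_ : i + j + a = b), tpow k V i * Ra * tpow k V j
        ≤ (TwoSidedIdeal.asIdeal I).restrictScalars k :=
      iSup_le fun i => iSup_le fun j => iSup_le fun _ x hx =>
        TwoSidedIdeal.mem_asIdeal.mpr (I.mem_of_mem_mul_mul hRaI hx)
    exact fun x hx => TwoSidedIdeal.mem_asIdeal.mp (hle hx)
  rw [TwoSidedIdeal.span_le]
  rintro x (hx | hx)
  · exact hRaI x hx
  · rw [SetLike.mem_coe, ← hsup] at hx
    obtain ⟨y, hy, z, hz, rfl⟩ := Submodule.mem_sup.mp hx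
    exact I.add_mem (hS y hy.1) (TwoSidedIdeal.subset_span (Or.inr hz))
end

section
/- Let R be a ring, M a left R-module, and E, E', F_1, …, F_t, G_1, …, G_{t'} submodules of M. If the 4-tuple (E, E', F_1+⋯+F_t, G_1+⋯+G_{t'}) is multidistributive, then E ∩ (G_1+⋯+G_{t'}) ⊆ E ∩ (F_1+⋯+F_t) and E' ∩ (F_1+⋯+F_t) ⊆ E' ∩ (G_1+⋯+G_{t'}). -/
/-- In a modular lattice, an element below both `e` and `a ⊔ b` is below `a`, provided that `a ≤ e`
and `b` is disjoint from `e`. -/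
theorem le_left_of_le_sup_of_disjoint {α : Type*} [Lattice α] [OrderBot α] [IsModularLattice α]
    {e a b x : α} (hae : a ≤ e) (hbe : Disjoint b e) (hxe : x ≤ e) (hx : x ≤ a ⊔ b) : x ≤ a := by
  have h : x ≤ (a ⊔ b) ⊓ e := le_inf hx hxe
  rwa [sup_inf_assoc_of_le b hae, hbe.eq_bot, sup_bot_eq] at h

/-- if the 4-tuple `(E, E', F_1+⋯+F_t, G_1+⋯+G_{t'})` of submodules of `M`
is multidistributive, then `E ∩ (G_1+⋯+G_{t'}) ⊆ E ∩ (F_1+⋯+F_t)` and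
`E' ∩ (F_1+⋯+F_t) ⊆ E' ∩ (G_1+⋯+G_{t'})`.  (The sum of a family of submodules is its
supremum.) -/
theorem stmt6 (R M : Type*) [Ring R] [AddCommGroup M] [Module R M]
    (t t' : ℕ) (E E' : Submodule R M)
    (F : Fin t → Submodule R M) (G : Fin t' → Submodule R M)
    (hdisj : E ⊓ E' = ⊥)
    (hmd : (E ⊔ E') ⊓ ((⨆ i, F i) ⊔ ⨆ j, G j)
            = (⨆ i, E ⊓ F i) ⊔ ⨆ j, E' ⊓ G j) :
    E ⊓ (⨆ j, G j) ≤ E ⊓ (⨆ i, F i) ∧ E' ⊓ (⨆ i, F i) ≤ E' ⊓ (⨆ j, G j) := by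
  have hd : Disjoint E E' := disjoint_iff.mpr hdisj
  have hA : (⨆ i, E ⊓ F i) ≤ E ⊓ ⨆ i, F i := iSup_inf_le_inf_iSup F E
  have hB : (⨆ j, E' ⊓ G j) ≤ E' ⊓ ⨆ j, G j := iSup_inf_le_inf_iSup G E'
  have hAE := hA.trans inf_le_left
  have hBE := hB.trans inf_le_left
  constructor
  · refine le_trans ?_ hA
    exact le_left_of_le_sup_of_disjoint hAE (hd.symm.mono_left hBE) inf_le_left
      ((inf_le_inf le_sup_left le_sup_right).trans hmd.le)
  · refine le_trans ?_ hB
    exact le_left_of_le_sup_of_disjoint hBE (hd.mono_left hAE) inf_le_left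
      ((inf_le_inf le_sup_right le_sup_left).trans (hmd.le.trans (sup_comm _ _).le))
end

section
/- Let k be a field, V a k-vector space, and 𝒮 a family of subspaces of V closed under sum and intersection such that every triple (X, Y, Z) of members of 𝒮 is distributive, i.e. X∩(Y+Z) = (X∩Y)+(X∩Z). Let E, E', F_1, F_2, G_1, …, G_{t'} ∈ 𝒮. If the 4-tuples (E, E', F_1, G_1+⋯+G_{t'}) and (E, E', F_2, G_1+⋯+G_{t'}) are multidistributive, then so are the 4-tuples (E, E', F_1+F_2, G_1+⋯+G_{t'}) and (E, E', F_1∩F_2, G_1+⋯+G_{t'}). -/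
/-- A set of elements containing `⊥` and closed under `⊔` is closed under finite suprema. -/
theorem iSup_mem_of_sup_mem {α : Type*} [CompleteLattice α] {S : Set α} (hbot : ⊥ ∈ S)
    (hsup : ∀ p ∈ S, ∀ q ∈ S, p ⊔ q ∈ S) {ι : Type*} [Fintype ι] (G : ι → α)
    (hG : ∀ j, G j ∈ S) : ⨆ j, G j ∈ S := by
  rw [← Finset.sup_univ_eq_iSup]
  exact Finset.sup_mem S hbot hsup _ _ fun j _ => hG j

/-- let `𝒮` be a family of subspaces of `V` closed under sum and
intersection in which every triple is distributive.  If `(E, E', F₁, G_1+⋯+G_{t'})` and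
`(E, E', F₂, G_1+⋯+G_{t'})` are multidistributive, then so are
`(E, E', F₁+F₂, G_1+⋯+G_{t'})` and `(E, E', F₁∩F₂, G_1+⋯+G_{t'})`. -/
theorem stmt7 (k V : Type*) [Field k] [AddCommGroup V] [Module k V]
    (S : Set (Submodule k V))
    (hsup : ∀ p ∈ S, ∀ q ∈ S, p ⊔ q ∈ S)
    (hinf : ∀ p ∈ S, ∀ q ∈ S, p ⊓ q ∈ S)
    (hdist : ∀ X ∈ S, ∀ Y ∈ S, ∀ Z ∈ S, X ⊓ (Y ⊔ Z) = (X ⊓ Y) ⊔ (X ⊓ Z))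
    (t' : ℕ) (E E' F₁ F₂ : Submodule k V) (G : Fin t' → Submodule k V)
    (hE : E ∈ S) (hE' : E' ∈ S) (hF₁ : F₁ ∈ S) (hF₂ : F₂ ∈ S) (hG : ∀ j, G j ∈ S)
    (h₁ : E ⊓ E' = ⊥ ∧
      (E ⊔ E') ⊓ (F₁ ⊔ ⨆ j, G j) = (E ⊓ F₁) ⊔ ⨆ j, E' ⊓ G j)
    (h₂ : E ⊓ E' = ⊥ ∧
      (E ⊔ E') ⊓ (F₂ ⊔ ⨆ j, G j) = (E ⊓ F₂) ⊔ ⨆ j, E' ⊓ G j) :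
    (E ⊓ E' = ⊥ ∧
      (E ⊔ E') ⊓ ((F₁ ⊔ F₂) ⊔ ⨆ j, G j) = ((E ⊓ F₁) ⊔ (E ⊓ F₂)) ⊔ ⨆ j, E' ⊓ G j) ∧
    (E ⊓ E' = ⊥ ∧
      (E ⊔ E') ⊓ ((F₁ ⊓ F₂) ⊔ ⨆ j, G j) = (E ⊓ (F₁ ⊓ F₂)) ⊔ ⨆ j, E' ⊓ G j) := by
  have hbot : (⊥ : Submodule k V) ∈ S := h₁.1 ▸ hinf E hE E' hE'
  have hH : ⨆ j, G j ∈ S := iSup_mem_of_sup_mem hbot hsup G hG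
  have hK : ⨆ j, E' ⊓ G j ∈ S :=
    iSup_mem_of_sup_mem hbot hsup _ fun j => hinf E' hE' _ (hG j)
  have hKE' : ⨆ j, E' ⊓ G j ≤ E' := iSup_le fun j => inf_le_left
  have hKH : ⨆ j, E' ⊓ G j ≤ ⨆ j, G j := iSup_mono fun j => inf_le_right
  obtain ⟨hEE', h₁⟩ := h₁
  obtain ⟨-, h₂⟩ := h₂
  generalize (⨆ j, G j) = H at *
  generalize (⨆ j, E' ⊓ G j) = K at *
  refine ⟨⟨hEE', ?_⟩, hEE', le_antisymm ?_ ?_⟩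
  · rw [sup_sup_distrib_right F₁ F₂ H, hdist _ (hsup E hE E' hE') _ (hsup F₁ hF₁ H hH) _
      (hsup F₂ hF₂ H hH), h₁, h₂, ← sup_sup_distrib_right]
  · have hA : E ⊓ F₁ ∈ S := hinf E hE F₁ hF₁
    have hB : E ⊓ F₂ ∈ S := hinf E hE F₂ hF₂
    calc (E ⊔ E') ⊓ ((F₁ ⊓ F₂) ⊔ H)
        ≤ ((E ⊓ F₁) ⊔ K) ⊓ ((E ⊓ F₂) ⊔ K) := by
          rw [← h₁, ← h₂]
          exact le_inf (inf_le_inf_left _ (sup_le_sup_right inf_le_left _))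
            (inf_le_inf_left _ (sup_le_sup_right inf_le_right _))
      _ = ((E ⊓ F₂) ⊓ (E ⊓ F₁) ⊔ (E ⊓ F₂) ⊓ K) ⊔ K := by
          rw [hdist _ (hsup _ hA K hK) _ hB K hK, inf_eq_right.2 (le_sup_right : K ≤ _),
            inf_comm, hdist _ hB _ hA K hK]
      _ ≤ (E ⊓ (F₁ ⊓ F₂)) ⊔ K := by
          refine sup_le (sup_le (le_sup_of_le_left ?_) (le_sup_of_le_right inf_le_right))
            le_sup_right
          rw [inf_inf_distrib_left E, inf_comm]
  · exact sup_le (inf_le_inf le_sup_left le_sup_left)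
      (le_inf (hKE'.trans le_sup_right) (hKH.trans le_sup_right))
end

section
/- Let k be a field, V a k-vector space, and 𝒮 a family of subspaces of V closed under sum and intersection such that every triple (X, Y, Z) of members of 𝒮 is distributive, i.e. X∩(Y+Z) = (X∩Y)+(X∩Z). Let E_1, E_2, E', F_1, …, F_t, G_1, …, G_{t'} ∈ 𝒮. If the 4-tuples (E_1, E', F_1+⋯+F_t, G_1+⋯+G_{t'}) and (E_2, E', F_1+⋯+F_t, G_1+⋯+G_{t'}) are multidistributive, then so are the 4-tuples (E_1+E_2, E', F_1+⋯+F_t, G_1+⋯+G_{t'}) and (E_1∩E_2, E', F_1+⋯+F_t, G_1+⋯+G_{t'}). -/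
section DistributiveFamily

variable {α : Type*} [CompleteLattice α] {T : Set α}

lemma iSup_mem_of_sup_mem_s8 {ι : Type*} [Fintype ι] (hbot : ⊥ ∈ T)
    (hsup : ∀ p ∈ T, ∀ q ∈ T, p ⊔ q ∈ T) {f : ι → α} (hf : ∀ i, f i ∈ T) :
    ⨆ i, f i ∈ T := by
  rw [← Finset.sup_univ_eq_iSup]
  exact Finset.sup_mem T hbot hsup _ _ fun i _ => hf i

lemma inf_iSup_eq_of_inf_sup_eq {ι : Type*} [Fintype ι] (hbot : ⊥ ∈ T)
    (hsup : ∀ p ∈ T, ∀ q ∈ T, p ⊔ q ∈ T)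
    (hdist : ∀ x ∈ T, ∀ y ∈ T, ∀ z ∈ T, x ⊓ (y ⊔ z) = (x ⊓ y) ⊔ (x ⊓ z))
    {x : α} (hx : x ∈ T) {f : ι → α} (hf : ∀ i, f i ∈ T) :
    x ⊓ ⨆ i, f i = ⨆ i, x ⊓ f i := by
  classical
  rw [← Finset.sup_univ_eq_iSup, ← Finset.sup_univ_eq_iSup]
  induction (Finset.univ : Finset ι) using Finset.induction_on with
  | empty => simp
  | insert a s _ ih =>
    rw [Finset.sup_insert, Finset.sup_insert,
      hdist x hx _ (hf a) _ (Finset.sup_mem T hbot hsup _ _ fun i _ => hf i), ih]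

lemma sup_inf_sup_eq_of_inf_sup_eq (hsup : ∀ p ∈ T, ∀ q ∈ T, p ⊔ q ∈ T)
    (hdist : ∀ x ∈ T, ∀ y ∈ T, ∀ z ∈ T, x ⊓ (y ⊔ z) = (x ⊓ y) ⊔ (x ⊓ z))
    {a b c : α} (ha : a ∈ T) (hb : b ∈ T) (hc : c ∈ T) :
    (a ⊔ c) ⊓ (b ⊔ c) = a ⊓ b ⊔ c := by
  rw [hdist _ (hsup a ha c hc) b hb c hc, inf_comm (a ⊔ c) b, hdist b hb a ha c hc,
    inf_eq_right.2 (le_sup_right : c ≤ a ⊔ c), sup_assoc,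
    sup_eq_right.2 (inf_le_right : b ⊓ c ≤ c), inf_comm b a]

/-- Over a family closed under `⊔` and `⊓` and distributive, multidistributivity with one summand on each side is preserved by `⊔` and `⊓` in the first entry. -/
lemma multidistributive_sup_and_inf (hsup : ∀ p ∈ T, ∀ q ∈ T, p ⊔ q ∈ T)
    (hinf : ∀ p ∈ T, ∀ q ∈ T, p ⊓ q ∈ T)
    (hdist : ∀ x ∈ T, ∀ y ∈ T, ∀ z ∈ T, x ⊓ (y ⊔ z) = (x ⊓ y) ⊔ (x ⊓ z))
    {a b e f g : α} (ha : a ∈ T) (hb : b ∈ T) (he : e ∈ T) (hf : f ∈ T) (hg : g ∈ T)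
    (h₁ : a ⊓ e = ⊥ ∧ (a ⊔ e) ⊓ (f ⊔ g) = a ⊓ f ⊔ e ⊓ g)
    (h₂ : b ⊓ e = ⊥ ∧ (b ⊔ e) ⊓ (f ⊔ g) = b ⊓ f ⊔ e ⊓ g) :
    ((a ⊔ b) ⊓ e = ⊥ ∧ (a ⊔ b ⊔ e) ⊓ (f ⊔ g) = (a ⊔ b) ⊓ f ⊔ e ⊓ g) ∧
      (a ⊓ b ⊓ e = ⊥ ∧ (a ⊓ b ⊔ e) ⊓ (f ⊔ g) = a ⊓ b ⊓ f ⊔ e ⊓ g) := by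
  have hdist' : ∀ x ∈ T, ∀ y ∈ T, ∀ z ∈ T, (y ⊔ z) ⊓ x = y ⊓ x ⊔ z ⊓ x := by
    intro x hx y hy z hz
    rw [inf_comm, hdist x hx y hy z hz, inf_comm x y, inf_comm x z]
  refine ⟨⟨?_, ?_⟩, ?_, ?_⟩
  · rw [hdist' e he a ha b hb, h₁.1, h₂.1, sup_bot_eq]
  · rw [sup_sup_distrib_right, hdist' _ (hsup f hf g hg) _ (hsup a ha e he) _ (hsup b hb e he),
      h₁.2, h₂.2, ← sup_sup_distrib_right, hdist' f hf a ha b hb]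
  · rw [inf_assoc, h₂.1, inf_bot_eq]
  · rw [← sup_inf_sup_eq_of_inf_sup_eq hsup hdist ha hb he, inf_inf_distrib_right, h₁.2, h₂.2,
      sup_inf_sup_eq_of_inf_sup_eq hsup hdist (hinf a ha f hf) (hinf b hb f hf) (hinf e he g hg),
      ← inf_inf_distrib_right]

end DistributiveFamily

/-- let `𝒮` be a family of subspaces of `V` closed under sum and
intersection in which every triple is distributive.  If
`(E₁, E', F_1+⋯+F_t, G_1+⋯+G_{t'})` and `(E₂, E', F_1+⋯+F_t, G_1+⋯+G_{t'})` are
multidistributive, then so are `(E₁+E₂, E', F_1+⋯+F_t, G_1+⋯+G_{t'})` and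
`(E₁∩E₂, E', F_1+⋯+F_t, G_1+⋯+G_{t'})`. -/
theorem stmt8 (k V : Type*) [Field k] [AddCommGroup V] [Module k V]
    (S : Set (Submodule k V))
    (hsup : ∀ p ∈ S, ∀ q ∈ S, p ⊔ q ∈ S)
    (hinf : ∀ p ∈ S, ∀ q ∈ S, p ⊓ q ∈ S)
    (hdist : ∀ X ∈ S, ∀ Y ∈ S, ∀ Z ∈ S, X ⊓ (Y ⊔ Z) = (X ⊓ Y) ⊔ (X ⊓ Z))
    (t t' : ℕ) (E₁ E₂ E' : Submodule k V)
    (F : Fin t → Submodule k V) (G : Fin t' → Submodule k V)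
    (hE₁ : E₁ ∈ S) (hE₂ : E₂ ∈ S) (hE' : E' ∈ S)
    (hF : ∀ i, F i ∈ S) (hG : ∀ j, G j ∈ S)
    (h₁ : E₁ ⊓ E' = ⊥ ∧
      (E₁ ⊔ E') ⊓ ((⨆ i, F i) ⊔ ⨆ j, G j) = (⨆ i, E₁ ⊓ F i) ⊔ ⨆ j, E' ⊓ G j)
    (h₂ : E₂ ⊓ E' = ⊥ ∧
      (E₂ ⊔ E') ⊓ ((⨆ i, F i) ⊔ ⨆ j, G j) = (⨆ i, E₂ ⊓ F i) ⊔ ⨆ j, E' ⊓ G j) :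
    ((E₁ ⊔ E₂) ⊓ E' = ⊥ ∧
      ((E₁ ⊔ E₂) ⊔ E') ⊓ ((⨆ i, F i) ⊔ ⨆ j, G j)
        = (⨆ i, (E₁ ⊔ E₂) ⊓ F i) ⊔ ⨆ j, E' ⊓ G j) ∧
    ((E₁ ⊓ E₂) ⊓ E' = ⊥ ∧
      ((E₁ ⊓ E₂) ⊔ E') ⊓ ((⨆ i, F i) ⊔ ⨆ j, G j)
        = (⨆ i, (E₁ ⊓ E₂) ⊓ F i) ⊔ ⨆ j, E' ⊓ G j) := by
  have hbot : (⊥ : Submodule k V) ∈ insert ⊥ S := Set.mem_insert _ _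
  have hsup' : ∀ p ∈ insert ⊥ S, ∀ q ∈ insert ⊥ S, p ⊔ q ∈ insert ⊥ S := by
    rintro p (rfl | hp) q (rfl | hq)
    · simp
    · simp [hq]
    · simp [hp]
    · exact Or.inr (hsup p hp q hq)
  have hinf' : ∀ p ∈ insert ⊥ S, ∀ q ∈ insert ⊥ S, p ⊓ q ∈ insert ⊥ S := by
    rintro p (rfl | hp) q (rfl | hq)
    · simp
    · simp
    · simp
    · exact Or.inr (hinf p hp q hq)
  have hdist' : ∀ X ∈ insert ⊥ S, ∀ Y ∈ insert ⊥ S, ∀ Z ∈ insert ⊥ S,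
      X ⊓ (Y ⊔ Z) = (X ⊓ Y) ⊔ (X ⊓ Z) := by
    rintro X (rfl | hX) Y (rfl | hY) Z (rfl | hZ)
    all_goals first | exact hdist X hX Y hY Z hZ | simp
  have hF' : ∀ i, F i ∈ insert ⊥ S := fun i => Or.inr (hF i)
  have hG' : ∀ j, G j ∈ insert ⊥ S := fun j => Or.inr (hG j)
  have hE₁' : E₁ ∈ insert ⊥ S := Or.inr hE₁
  have hE₂' : E₂ ∈ insert ⊥ S := Or.inr hE₂
  have hE'' : E' ∈ insert ⊥ S := Or.inr hE'
  have distF {X : Submodule k V} (hX : X ∈ insert ⊥ S) :=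
    inf_iSup_eq_of_inf_sup_eq hbot hsup' hdist' hX hF'
  rw [← inf_iSup_eq_of_inf_sup_eq hbot hsup' hdist' hE'' hG'] at h₁ h₂ ⊢
  rw [← distF hE₁'] at h₁
  rw [← distF hE₂'] at h₂
  rw [← distF (hsup' _ hE₁' _ hE₂'), ← distF (hinf' _ hE₁' _ hE₂')]
  exact multidistributive_sup_and_inf hsup' hinf' hdist' hE₁' hE₂' hE''
    (iSup_mem_of_sup_mem_s8 hbot hsup' hF') (iSup_mem_of_sup_mem_s8 hbot hsup' hG') h₁ h₂
end

section
/- Let k be a field, V a finite-dimensional k-vector space, N ≥ 2 an integer, and R ⊆ V^{⊗N} a subspace. Then the equality (V^{⊗(N-1)}⊗R) ∩ (Σ_{i=0}^{N-2} V^{⊗i}⊗R⊗V^{⊗(N-1-i)}) = V^{⊗(N-2)}⊗J_{N+1}(R), where J_{N+1}(R) = (V⊗R) ∩ (R⊗V), holds if and only if for every m with 2 ≤ m ≤ N-1 the triple (V^{⊗m}⊗R, R⊗V^{⊗m}, Σ_{i=1}^{m-1} V^{⊗i}⊗R⊗V^{⊗(m-i)}) of subspaces of V^{⊗(N+m)}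 is distributive and the inclusion (V^{⊗m}⊗R) ∩ (R⊗V^{⊗m}) ⊆ V^{⊗(m-1)}⊗R⊗V holds. -/
namespace TensorAlgebra

variable {k V : Type*}

section CommRing

variable [CommRing k] [AddCommGroup V] [Module k V]

/-- The algebra morphism `x ↦ !![ε x, ∂ x; 0, x]`, where `ε` is the augmentation and `∂` is
left contraction with `f`. -/
noncomputable def contractionMatrix (f : V →ₗ[k] k) :
    TensorAlgebra k V →ₐ[k] Matrix (Fin 2) (Fin 2) (TensorAlgebra k V) :=
  lift k
    { toFun := fun v => !![0, algebraMap k _ (f v); 0, ι k v]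
      map_add' := fun v w => by
        ext i j
        fin_cases i <;> fin_cases j <;> simp
      map_smul' := fun c v => by
        ext i j
        fin_cases i <;> fin_cases j <;> simp [Algebra.smul_def] }

theorem contractionMatrix_ι (f : V →ₗ[k] k) (v : V) :
    contractionMatrix f (ι k v) = !![0, algebraMap k _ (f v); 0, ι k v] := by
  simp [contractionMatrix]

theorem contractionMatrix_lower_row (f : V →ₗ[k] k) (x : TensorAlgebra k V) :
    contractionMatrix f x 1 0 = 0 ∧ contractionMatrix f x 1 1 = x := by
  induction x using TensorAlgebra.induction with
  | algebraMap r => simp [Matrix.algebraMap_matrix_apply]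
  | ι v => simp [contractionMatrix_ι]
  | mul a b ha hb => simp [Matrix.mul_apply, ha, hb]
  | add a b ha hb => simp [ha, hb]

/-- Left contraction of tensors with a linear form `f`: it sends `v₁ ⊗ ⋯ ⊗ vₙ` to
`f v₁ • v₂ ⊗ ⋯ ⊗ vₙ`. -/
noncomputable def contractLeft (f : V →ₗ[k] k) : TensorAlgebra k V →ₗ[k] TensorAlgebra k V where
  toFun x := contractionMatrix f x 0 1
  map_add' x y := by simp
  map_smul' c x := by simp

theorem contractLeft_ι_mul (f : V →ₗ[k] k) (v : V) (x : TensorAlgebra k V) :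
    contractLeft f (ι k v * x) = f v • x := by
  simp [contractLeft, contractionMatrix_ι, Matrix.mul_apply, (contractionMatrix_lower_row f x).2,
    Algebra.smul_def]

theorem contractLeft_mem {f : V →ₗ[k] k} {X : Submodule k (TensorAlgebra k V)}
    {z : TensorAlgebra k V} (hz : z ∈ LinearMap.range (ι k (M := V)) * X) :
    contractLeft f z ∈ X := by
  induction hz using Submodule.mul_induction_on' with
  | mem_mul_mem a ha x hx =>
    obtain ⟨v, rfl⟩ := ha
    rw [contractLeft_ι_mul]
    exact X.smul_mem _ hx
  | add a _ b _ ha hb => simpa using X.add_mem ha hb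

theorem sum_ι_mul_contractLeft {κ : Type*} [Fintype κ] (b : Module.Basis κ k V)
    {X : Submodule k (TensorAlgebra k V)} {z : TensorAlgebra k V}
    (hz : z ∈ LinearMap.range (ι k (M := V)) * X) :
    ∑ i, ι k (b i) * contractLeft (b.coord i) z = z := by
  induction hz using Submodule.mul_induction_on' with
  | mem_mul_mem a ha x hx =>
    obtain ⟨v, rfl⟩ := ha
    simp only [contractLeft_ι_mul, mul_smul_comm, ← smul_mul_assoc, ← Finset.sum_mul, ← map_smul,
      ← map_sum, Module.Basis.coord_apply, b.sum_repr]
  | add a _ c _ ha hc => simp [mul_add, Finset.sum_add_distrib, ha, hc]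

theorem range_ι_mul_inf [Module.Free k V] [Module.Finite k V]
    (X Y : Submodule k (TensorAlgebra k V)) :
    LinearMap.range (ι k (M := V)) * (X ⊓ Y) =
      LinearMap.range (ι k (M := V)) * X ⊓ LinearMap.range (ι k (M := V)) * Y := by
  refine le_antisymm (le_inf (mul_le_mul_right inf_le_left _) (mul_le_mul_right inf_le_right _)) ?_
  rintro z ⟨hX, hY⟩
  rw [← sum_ι_mul_contractLeft (Module.Free.chooseBasis k V) hX]
  exact Submodule.sum_mem _ fun i _ =>
    Submodule.mul_mem_mul ⟨_, rfl⟩ ⟨contractLeft_mem hX, contractLeft_mem hY⟩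

end CommRing

theorem le_of_range_ι_mul_le [Field k] [AddCommGroup V] [Module k V] [Nontrivial V]
    {X Y : Submodule k (TensorAlgebra k V)}
    (h : LinearMap.range (ι k (M := V)) * X ≤ LinearMap.range (ι k (M := V)) * Y) : X ≤ Y := by
  intro x hx
  obtain ⟨v, hv⟩ := exists_ne (0 : V)
  obtain ⟨f, hf⟩ := Module.Projective.exists_dual_ne_zero k hv
  have hmem := contractLeft_mem (f := f) (h (Submodule.mul_mem_mul ⟨v, rfl⟩ hx))
  rw [contractLeft_ι_mul] at hmem
  exact (Y.smul_mem_iff hf).1 hmem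

end TensorAlgebra

section Shift

variable {k A : Type*} [CommSemiring k] [Semiring A] [Algebra k A]

theorem mul_iSup_range_pow_mul_mul_pow (W R : Submodule k A) (m : ℕ) :
    W * (⨆ i ∈ Finset.range m, W ^ i * R * W ^ (m - i)) =
      ⨆ i ∈ Finset.Icc 1 m, W ^ i * R * W ^ (m + 1 - i) := by
  have himage : Finset.Icc 1 m = (Finset.range m).image Nat.succ := by
    ext i
    simp only [Finset.mem_Icc, Finset.mem_image, Finset.mem_range]
    exact ⟨fun h => ⟨i - 1, by omega, by omega⟩, by rintro ⟨j, hj, rfl⟩; omega⟩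
  simp only [himage, Finset.iSup_finset_image, Submodule.mul_iSup, pow_succ', mul_assoc,
    Nat.succ_eq_add_one, Nat.add_sub_add_right]

theorem iSup_range_succ_pow_mul_mul_pow (W R : Submodule k A) (m : ℕ) :
    (⨆ i ∈ Finset.range (m + 1), W ^ i * R * W ^ (m + 1 - i)) =
      R * W ^ (m + 1) ⊔ ⨆ i ∈ Finset.Icc 1 m, W ^ i * R * W ^ (m + 1 - i) := by
  have hinsert : Finset.range (m + 1) = insert 0 (Finset.Icc 1 m) := by
    ext i
    simp only [Finset.mem_insert, Finset.mem_Icc, Finset.mem_range]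
    omega
  rw [hinsert, Finset.iSup_insert]
  simp

/-- The relation `(W^m R) ∩ (∑_{i < m} W^i R W^{m-i}) ⊆ W^{m-1} R W`. -/
def LastOverlap (W R : Submodule k A) (m : ℕ) : Prop :=
  W ^ m * R ⊓ (⨆ i ∈ Finset.range m, W ^ i * R * W ^ (m - i)) ≤ W ^ (m - 1) * R * W

theorem LastOverlap.of_succ {W R : Submodule k A}
    (hcancel : ∀ X Y : Submodule k A, W * X ≤ W * Y → X ≤ Y) {m : ℕ} (hm : 1 ≤ m)
    (h : LastOverlap W R (m + 1)) : LastOverlap W R m := by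
  apply hcancel
  obtain ⟨n, rfl⟩ := Nat.exists_eq_add_of_le' hm
  refine le_trans (le_inf ?_ ?_) (h.trans (le_of_eq ?_))
  · rw [pow_succ' W (n + 1), mul_assoc]
    exact mul_le_mul_right inf_le_left _
  · rw [iSup_range_succ_pow_mul_mul_pow W R (n + 1), ← mul_iSup_range_pow_mul_mul_pow]
    exact (mul_le_mul_right inf_le_right _).trans le_sup_right
  · simp [pow_succ', mul_assoc]

theorem LastOverlap.of_le {W R : Submodule k A}
    (hcancel : ∀ X Y : Submodule k A, W * X ≤ W * Y → X ≤ Y) {m n : ℕ} (hm : 1 ≤ m)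
    (hmn : m ≤ n) (h : LastOverlap W R n) : LastOverlap W R m := by
  induction n, hmn using Nat.le_induction with
  | base => exact h
  | succ n hn ih => exact ih (h.of_succ hcancel (hm.trans hn))

theorem lastOverlap_one (W R : Submodule k A) : LastOverlap W R 1 := by
  simp [LastOverlap]

/-- Distributivity of `(W^m R, R W^m, ∑_{1 ≤ i < m} W^i R W^{m-i})` together with the inclusion
`(W^m R) ∩ (R W^m) ⊆ W^{m-1} R W`. -/
def DistributiveOverlap (W R : Submodule k A) (m : ℕ) : Prop :=
  (W ^ m * R ⊓ (R * W ^ m ⊔ ⨆ i ∈ Finset.Icc 1 (m - 1), W ^ i * R * W ^ (m - i)) =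
    (W ^ m * R ⊓ R * W ^ m) ⊔
      (W ^ m * R ⊓ ⨆ i ∈ Finset.Icc 1 (m - 1), W ^ i * R * W ^ (m - i))) ∧
  W ^ m * R ⊓ R * W ^ m ≤ W ^ (m - 1) * R * W

theorem LastOverlap.distributiveOverlap {W R : Submodule k A} {m : ℕ} (hm : 2 ≤ m)
    (h : LastOverlap W R m) : DistributiveOverlap W R m := by
  obtain ⟨n, rfl⟩ := Nat.exists_eq_add_of_le' hm
  rw [LastOverlap, iSup_range_succ_pow_mul_mul_pow] at h
  refine ⟨le_antisymm ?_ ?_, (inf_le_inf_left _ le_sup_left).trans h⟩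
  · refine le_sup_of_le_right (le_inf inf_le_left (h.trans ?_))
    refine le_trans (le_of_eq ?_) (le_iSup₂_of_le (n + 1) (by simp) le_rfl)
    simp [show n + 2 - (n + 1) = 1 by omega]
  · exact sup_le (inf_le_inf_left _ le_sup_left) (inf_le_inf_left _ le_sup_right)

theorem LastOverlap.succ {W R : Submodule k A}
    (hinf : ∀ X Y : Submodule k A, W * (X ⊓ Y) = W * X ⊓ W * Y) {m : ℕ} (hm : 1 ≤ m)
    (h : LastOverlap W R m) (hd : DistributiveOverlap W R (m + 1)) :
    LastOverlap W R (m + 1) := by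
  obtain ⟨n, rfl⟩ := Nat.exists_eq_add_of_le' hm
  obtain ⟨hdist, hincl⟩ := hd
  rw [Nat.add_sub_cancel] at hdist hincl
  rw [LastOverlap, iSup_range_succ_pow_mul_mul_pow, hdist]
  refine sup_le hincl ?_
  rw [← mul_iSup_range_pow_mul_mul_pow, pow_succ' W (n + 1), mul_assoc, ← hinf]
  refine (mul_le_mul_right h _).trans (le_of_eq ?_)
  simp [pow_succ', mul_assoc]

theorem lastOverlap_iff_forall_distributiveOverlap {W R : Submodule k A}
    (hinf : ∀ X Y : Submodule k A, W * (X ⊓ Y) = W * X ⊓ W * Y)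
    (hcancel : ∀ X Y : Submodule k A, W * X ≤ W * Y → X ≤ Y) {n : ℕ} (hn : 1 ≤ n) :
    LastOverlap W R n ↔ ∀ m, 2 ≤ m → m ≤ n → DistributiveOverlap W R m := by
  refine ⟨fun h m hm hmn => (h.of_le hcancel (by omega) hmn).distributiveOverlap hm, fun h => ?_⟩
  induction n, hn using Nat.le_induction with
  | base => exact lastOverlap_one W R
  | succ n hn ih =>
    exact (ih fun m hm hmn => h m hm (by omega)).succ hinf hn (h _ (by omega) le_rfl)

theorem pow_mul_inf {W : Submodule k A}
    (hinf : ∀ X Y : Submodule k A, W * (X ⊓ Y) = W * X ⊓ W * Y) (n : ℕ) (X Y : Submodule k A) :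
    W ^ n * (X ⊓ Y) = W ^ n * X ⊓ W ^ n * Y := by
  induction n with
  | zero => simp
  | succ n ih => simp only [pow_succ', mul_assoc, ih, hinf]

theorem lastOverlap_succ_iff_eq {W : Submodule k A} (R : Submodule k A)
    (hinf : ∀ X Y : Submodule k A, W * (X ⊓ Y) = W * X ⊓ W * Y) (n : ℕ) :
    LastOverlap W R (n + 1) ↔
      W ^ (n + 1) * R ⊓ (⨆ i ∈ Finset.range (n + 1), W ^ i * R * W ^ (n + 1 - i)) =
        W ^ n * (W * R ⊓ R * W) := by
  rw [pow_mul_inf hinf, ← mul_assoc, ← mul_assoc, ← pow_succ, LastOverlap, Nat.add_sub_cancel]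
  refine ⟨fun h => le_antisymm (le_inf inf_le_left h) (inf_le_inf_left _ ?_),
    fun h => h.trans_le inf_le_right⟩
  exact le_iSup₂_of_le n (by simp) (by simp)

end Shift

/-- for a subspace `R ⊆ V^{⊗N}` (`N ≥ 2`, `V` finite dimensional), the
equality `(V^{⊗(N-1)}⊗R) ∩ (Σ_{i=0}^{N-2} V^{⊗i}⊗R⊗V^{⊗(N-1-i)}) = V^{⊗(N-2)}⊗J_{N+1}(R)`
with `J_{N+1}(R) = (V⊗R) ∩ (R⊗V)` holds if and only if for every `2 ≤ m ≤ N-1` the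
triple `(V^{⊗m}⊗R, R⊗V^{⊗m}, Σ_{i=1}^{m-1} V^{⊗i}⊗R⊗V^{⊗(m-i)})` is distributive and
`(V^{⊗m}⊗R) ∩ (R⊗V^{⊗m}) ⊆ V^{⊗(m-1)}⊗R⊗V`. -/
theorem stmt9 (k V : Type*) [Field k] [AddCommGroup V] [Module k V]
    [FiniteDimensional k V]
    (N : ℕ) (hN : 2 ≤ N)
    (R : Submodule k (TensorAlgebra k V)) (hR : R ≤ tpow k V N) :
    ((tpow k V (N - 1) * R) ⊓
        (⨆ i ∈ Finset.range (N - 1), tpow k V i * R * tpow k V (N - 1 - i))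
      = tpow k V (N - 2) * ((tpow k V 1 * R) ⊓ (R * tpow k V 1)))
    ↔ (∀ m : ℕ, 2 ≤ m → m ≤ N - 1 →
        ((tpow k V m * R) ⊓
            ((R * tpow k V m) ⊔ ⨆ i ∈ Finset.Icc 1 (m - 1), tpow k V i * R * tpow k V (m - i))
          = ((tpow k V m * R) ⊓ (R * tpow k V m)) ⊔
            ((tpow k V m * R) ⊓ ⨆ i ∈ Finset.Icc 1 (m - 1), tpow k V i * R * tpow k V (m - i)))
        ∧ (tpow k V m * R) ⊓ (R * tpow k V m) ≤ tpow k V (m - 1) * R * tpow k V 1) := by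
  obtain ⟨n, rfl⟩ := Nat.exists_eq_add_of_le' hN
  have hinf := TensorAlgebra.range_ι_mul_inf (k := k) (V := V)
  simp only [tpow, pow_one, Nat.add_sub_cancel, show n + 2 - 1 = n + 1 by omega] at hR ⊢
  rcases subsingleton_or_nontrivial V with hV | hV
  · have hW : LinearMap.range (TensorAlgebra.ι k (M := V)) = ⊥ := by
      rw [LinearMap.range_eq_bot]
      exact Subsingleton.elim _ _
    have hbot : R = ⊥ := by
      rw [hW, pow_succ, Submodule.mul_bot] at hR
      exact le_bot_iff.1 hR
    subst hbot
    simp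
  · rw [← lastOverlap_succ_iff_eq R hinf n]
    exact lastOverlap_iff_forall_distributiveOverlap hinf
      (fun _ _ => TensorAlgebra.le_of_range_ι_mul_le) (by omega)
end

section
/- Let k be a field, V a finite-dimensional k-vector space, N ≥ 2 an integer, and R ⊆ V^{⊗N} a subspace. Then the inclusions (V^{⊗m}⊗R) ∩ (R⊗V^{⊗m}) ⊆ V^{⊗(m-1)}⊗R⊗V hold for all m with 2 ≤ m ≤ N-1 if and only if the equalities (V^{⊗m}⊗R) ∩ (R⊗V^{⊗m}) = J_{N+m}(R) hold for all m with 2 ≤ m ≤ N-1. -/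
/-- `J_n(R) = ⋂_{i+j+N=n} V^{⊗i}⊗R⊗V^{⊗j}` for a subspace `R ⊆ V^{⊗N}` and `n ≥ N`. -/
noncomputable def Jsub (k V : Type*) [CommSemiring k] [AddCommMonoid V] [Module k V]
    (N : ℕ) (R : Submodule k (TensorAlgebra k V)) (n : ℕ) :
    Submodule k (TensorAlgebra k V) :=
  ⨅ i ∈ Finset.range (n - N + 1), tpow k V i * R * tpow k V (n - N - i)

namespace TensorAlgebra

variable {k V : Type*} [Field k] [AddCommGroup V] [Module k V]

/-- The algebra map `T(V) → M₂(T(V))` sending `v` to `!![v, f v; 0, 0]`. -/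
noncomputable def contractHom (f : Module.Dual k V) :
    TensorAlgebra k V →ₐ[k] Matrix (Fin 2) (Fin 2) (TensorAlgebra k V) :=
  TensorAlgebra.lift k
    ((Matrix.singleLinearMap k 0 0).comp (ι k) +
      (Matrix.singleLinearMap k 0 1).comp ((Algebra.linearMap k (TensorAlgebra k V)).comp f))

theorem contractHom_ι (f : Module.Dual k V) (v : V) :
    contractHom f (ι k v) =
      Matrix.single 0 0 (ι k v) + Matrix.single 0 1 (algebraMap k (TensorAlgebra k V) (f v)) := by
  simp [contractHom]

theorem contractHom_firstColumn (f : Module.Dual k V) (x : TensorAlgebra k V) :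
    contractHom f x 0 0 = x ∧ contractHom f x 1 0 = 0 := by
  induction x using TensorAlgebra.induction with
  | algebraMap r => simp [Matrix.algebraMap_matrix_apply]
  | ι v => simp [contractHom_ι]
  | mul a b ha hb => simp [Matrix.mul_apply, Fin.sum_univ_two, ha.1, ha.2, hb.1, hb.2]
  | add a b ha hb => simp [ha.1, ha.2, hb.1, hb.2]

/-- Contraction of the last tensor factor against a linear form. -/
noncomputable def contractLast (f : Module.Dual k V) :
    TensorAlgebra k V →ₗ[k] TensorAlgebra k V :=
  (Matrix.entryLinearMap k (TensorAlgebra k V) 0 1).comp (contractHom f).toLinearMap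

theorem contractLast_mul_ι (f : Module.Dual k V) (a : TensorAlgebra k V) (v : V) :
    contractLast f (a * ι k v) = f v • a := by
  simp [contractLast, contractHom_ι, Matrix.mul_apply, Fin.sum_univ_two,
    (contractHom_firstColumn f a).1, Algebra.smul_def, Algebra.commutes]

theorem contractLast_mem {A : Submodule k (TensorAlgebra k V)} (f : Module.Dual k V)
    {x : TensorAlgebra k V} (hx : x ∈ A * LinearMap.range (ι k (M := V))) :
    contractLast f x ∈ A := by
  induction hx using Submodule.mul_induction_on' with
  | mem_mul_mem a ha y hy =>
    obtain ⟨v, rfl⟩ := hy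
    rw [contractLast_mul_ι]
    exact A.smul_mem _ ha
  | add x _ y _ hx hy =>
    rw [map_add]
    exact A.add_mem hx hy

theorem sum_contractLast_mul_ι {κ : Type*} [Fintype κ] (b : Module.Basis κ k V)
    {A : Submodule k (TensorAlgebra k V)}
    {x : TensorAlgebra k V} (hx : x ∈ A * LinearMap.range (ι k (M := V))) :
    ∑ i, contractLast (b.coord i) x * ι k (b i) = x := by
  induction hx using Submodule.mul_induction_on' with
  | mem_mul_mem a ha y hy =>
    obtain ⟨v, rfl⟩ := hy
    conv_rhs => rw [← b.sum_repr v, map_sum, Finset.mul_sum]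
    simp only [contractLast_mul_ι, Module.Basis.coord_apply, map_smul, smul_mul_assoc,
      mul_smul_comm]
  | add x _ y _ hx hy => simp [add_mul, Finset.sum_add_distrib, hx, hy]

theorem inf_mul_range_ι_le [FiniteDimensional k V] (A B : Submodule k (TensorAlgebra k V)) :
    (A * LinearMap.range (ι k (M := V))) ⊓ (B * LinearMap.range (ι k (M := V))) ≤
      (A ⊓ B) * LinearMap.range (ι k (M := V)) := by
  rintro x ⟨hA, hB⟩
  rw [← sum_contractLast_mul_ι (Module.finBasis k V) hA]
  exact Submodule.sum_mem _ fun i _ => Submodule.mul_mem_mul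
    ⟨contractLast_mem _ hA, contractLast_mem _ hB⟩ ⟨_, rfl⟩

end TensorAlgebra

theorem tpow_mul_tpow (k V : Type*) [CommSemiring k] [AddCommMonoid V] [Module k V] (m n : ℕ) :
    tpow k V m * tpow k V n = tpow k V (m + n) :=
  (pow_add _ _ _).symm

theorem mem_Jsub_add {k V : Type*} [CommSemiring k] [AddCommMonoid V] [Module k V] {N m : ℕ}
    {R : Submodule k (TensorAlgebra k V)} {x : TensorAlgebra k V} :
    x ∈ Jsub k V N R (N + m) ↔ ∀ i ≤ m, x ∈ tpow k V i * R * tpow k V (m - i) := by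
  simp [Jsub, Submodule.mem_iInf]

theorem Jsub_add_le_inf {k V : Type*} [CommSemiring k] [AddCommMonoid V] [Module k V] (N m : ℕ)
    (R : Submodule k (TensorAlgebra k V)) :
    Jsub k V N R (N + m) ≤ (tpow k V m * R) ⊓ (R * tpow k V m) := by
  intro x hx
  rw [mem_Jsub_add] at hx
  exact ⟨by simpa [tpow] using hx m le_rfl, by simpa [tpow] using hx 0 m.zero_le⟩

/-- If the inclusions hold up to `M`, then the intersections are contained in `J_{N+m}(R)`. -/
theorem inf_le_Jsub_add {k V : Type*} [Field k] [AddCommGroup V] [Module k V]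
    [FiniteDimensional k V] (N M : ℕ) (R : Submodule k (TensorAlgebra k V))
    (h : ∀ m : ℕ, 2 ≤ m → m ≤ M →
      (tpow k V m * R) ⊓ (R * tpow k V m) ≤ tpow k V (m - 1) * R * tpow k V 1)
    (m : ℕ) (hm : m ≤ M) :
    (tpow k V m * R) ⊓ (R * tpow k V m) ≤ Jsub k V N R (N + m) := by
  induction m with
  | zero =>
    rintro x ⟨hx, -⟩
    rw [mem_Jsub_add]
    intro i hi
    obtain rfl : i = 0 := by omega
    simpa [tpow] using hx
  | succ m ih =>
    rintro x ⟨hl, hr⟩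
    rw [mem_Jsub_add]
    intro i hi
    obtain rfl | hlt := hi.eq_or_lt
    · simpa [tpow] using hl
    have hmid : x ∈ tpow k V m * R * tpow k V 1 := by
      rcases m.eq_zero_or_pos with rfl | hpos
      · simpa [tpow] using hr
      · exact h (m + 1) (by omega) hm ⟨hl, hr⟩
    have hr' : x ∈ R * tpow k V m * tpow k V 1 := by
      rwa [mul_assoc, tpow_mul_tpow]
    have hone : tpow k V 1 = LinearMap.range (TensorAlgebra.ι k (M := V)) := pow_one _
    rw [hone] at hmid hr'
    have hx := mul_le_mul' (ih (by omega)) le_rfl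
      (TensorAlgebra.inf_mul_range_ι_le _ _ ⟨hmid, hr'⟩)
    have hJ : Jsub k V N R (N + m) ≤ tpow k V i * R * tpow k V (m - i) := fun y hy =>
      mem_Jsub_add.1 hy i (by omega)
    have hxi := mul_le_mul' hJ le_rfl hx
    rwa [← hone, mul_assoc, tpow_mul_tpow, show m - i + 1 = m + 1 - i by omega] at hxi

/-- for a subspace `R ⊆ V^{⊗N}` (`N ≥ 2`, `V` finite dimensional), the
inclusions `(V^{⊗m}⊗R) ∩ (R⊗V^{⊗m}) ⊆ V^{⊗(m-1)}⊗R⊗V` hold for all `2 ≤ m ≤ N-1`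
if and only if the equalities `(V^{⊗m}⊗R) ∩ (R⊗V^{⊗m}) = J_{N+m}(R)` hold for all
`2 ≤ m ≤ N-1`. -/
theorem stmt10 (k V : Type*) [Field k] [AddCommGroup V] [Module k V]
    [FiniteDimensional k V]
    (N : ℕ) (hN : 2 ≤ N)
    (R : Submodule k (TensorAlgebra k V)) (hR : R ≤ tpow k V N) :
    (∀ m : ℕ, 2 ≤ m → m ≤ N - 1 →
        (tpow k V m * R) ⊓ (R * tpow k V m) ≤ tpow k V (m - 1) * R * tpow k V 1)
    ↔ (∀ m : ℕ, 2 ≤ m → m ≤ N - 1 →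
        (tpow k V m * R) ⊓ (R * tpow k V m) = Jsub k V N R (N + m)) := by
  constructor
  · intro h m _ hm
    exact le_antisymm (inf_le_Jsub_add N (N - 1) R h m hm) (Jsub_add_le_inf N m R)
  · intro h m hm hm' x hx
    rw [h m hm hm', mem_Jsub_add] at hx
    simpa only [show m - (m - 1) = 1 by omega] using hx (m - 1) (by omega)
end
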